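/- (Lemma 4, Inner-Triangle Distance Pruning, ball version) Let S_I be a finite set of points with |S_I| ≥ 2, S_R a finite set of points disjoint from S_I, p a natural number with |S_I| ≤ p, c a point, r ≥ 0 a real number, m a real number such that m ≤ d(v,q) for every v ∈ S_R and every point q with d(q,c) ≤ r, and D a real number. If (1/(|S_I| − 1))·∑_{{u,v}⊆S_I, u≠v} d(u,v) − |S_I|·r + (p − |S_I|)·m ≥ D, then for every point q with d(q,c) ≤ r and every completion F of S_I, ∑_{v∈F} d(v,q) ≥ D. -/

import Mathlib

theorem Finset.sum_offDiag_add {ι : Type*} [DecidableEq ι] (s : Finset ι) (f : ι → ℝ) :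
    ∑ z ∈ s.offDiag, (f z.1 + f z.2) = 2 * ((s.card : ℝ) - 1) * ∑ v ∈ s, f v := by
  have h : ∑ z ∈ s ×ˢ s, (f z.1 + f z.2) =
      ∑ z ∈ s.diag, (f z.1 + f z.2) + ∑ z ∈ s.offDiag, (f z.1 + f z.2) := by
    rw [← Finset.sum_union (Finset.disjoint_diag_offDiag s), Finset.diag_union_offDiag]
  have hprod : ∑ z ∈ s ×ˢ s, (f z.1 + f z.2) = 2 * (s.card : ℝ) * ∑ v ∈ s, f v := by
    rw [Finset.sum_product]
    simp only [Finset.sum_add_distrib, Finset.sum_const, nsmul_eq_mul, ← Finset.mul_sum]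
    ring
  have hdiag : ∑ z ∈ s.diag, (f z.1 + f z.2) = 2 * ∑ v ∈ s, f v := by
    rw [Finset.sum_diag, Finset.sum_add_distrib]
    ring
  linarith

theorem Finset.sum_offDiag_dist_le {X : Type*} [PseudoMetricSpace X] [DecidableEq X]
    (s : Finset X) (q : X) :
    ∑ z ∈ s.offDiag, dist z.1 z.2 ≤ 2 * ((s.card : ℝ) - 1) * ∑ v ∈ s, dist v q := by
  rw [← Finset.sum_offDiag_add]
  exact Finset.sum_le_sum fun z _ => dist_triangle_right z.1 z.2 q

/-- Lemma 4 (Inner-Triangle Distance Pruning, ball version). The ball has center `c` and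
radius `r`; `m` is a lower bound on the distance from any remaining candidate in `S_R` to
any point of the ball. The sum over unordered pairs of distinct points of `S_I` is
expressed as half of the sum over `S_I.offDiag`. -/
theorem inner_triangle_pruning_ball {X : Type*} [MetricSpace X] [DecidableEq X]
    (S_I S_R : Finset X) (hI : 2 ≤ S_I.card)
    (hdisj : Disjoint S_I S_R) (p : ℕ) (hp : S_I.card ≤ p)
    (c : X) (r : ℝ) (hr : 0 ≤ r) (m D : ℝ)
    (hm : ∀ v ∈ S_R, ∀ q : X, dist q c ≤ r → m ≤ dist v q)
    (hprune : (1 / ((S_I.card : ℝ) - 1)) * ((1 / 2) * ∑ z ∈ S_I.offDiag, dist z.1 z.2)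
        - (S_I.card : ℝ) * r + ((p : ℝ) - S_I.card) * m ≥ D) :
    ∀ q : X, dist q c ≤ r →
      ∀ F : Finset X, S_I ⊆ F → F \ S_I ⊆ S_R → F.card = p →
        ∑ v ∈ F, dist v q ≥ D := by
  intro q hq F hIF hFR hF
  have hn : (2 : ℝ) ≤ S_I.card := by exact_mod_cast hI
  have hinner : (1 / ((S_I.card : ℝ) - 1)) * ((1 / 2) * ∑ z ∈ S_I.offDiag, dist z.1 z.2)
      ≤ ∑ v ∈ S_I, dist v q := by
    rw [one_div_mul_eq_div, div_le_iff₀ (by linarith)]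
    linarith [Finset.sum_offDiag_dist_le S_I q]
  have houter : ((p : ℝ) - S_I.card) * m ≤ ∑ v ∈ F \ S_I, dist v q := by
    have h := Finset.card_nsmul_le_sum (F \ S_I) (fun v => dist v q) m
      fun v hv => hm v (hFR hv) q hq
    rwa [nsmul_eq_mul, Finset.card_sdiff_of_subset hIF, hF, Nat.cast_sub hp] at h
  have hr' : 0 ≤ (S_I.card : ℝ) * r := by positivity
  linarith [Finset.sum_sdiff (f := fun v => dist v q) hIF]
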